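/- arXiv:1312.1718 — 2 statements merged into one kernel-verified Lean document; each statement's English description precedes it below -/
import Mathlib

section
/- For every lower semicomputable semimeasure P with a fixed approximation (P_s) from below, every universal conditional semimeasure m(·|·) with a fixed approximation (m_t(·|·)) from below, and every computable function h : List Bool × ℕ → ℕ, the function u_h(x) = ⨅ s, m_{h(x,s)}(x|s) / P_s(x) is an upper semicomputable sumtest for P. -/
open scoped ENNReal NNReal

/-- Interpret a rational approximation value as an extended nonnegative real. -/
noncomputable def qval (q : ℚ) : ℝ≥0∞ := ENNReal.ofReal q

/-- Interpret a value in `ℚ≥0 ∪ {∞}` (with nonnegativity required separately)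
as an extended nonnegative real; `none` stands for `∞`. -/
noncomputable def qtval (q : Option ℚ) : ℝ≥0∞ := q.elim ⊤ (fun a => ENNReal.ofReal a)

/-- A (discrete) semimeasure on bitstrings. -/
def IsSemimeasure (P : List Bool → ℝ≥0∞) : Prop := ∑' x, P x ≤ 1

/-- `Ps` is a computable approximation of `P` from below (by nonnegative rationals,
nondecreasing in the stage). -/
def IsApproxFromBelow (P : List Bool → ℝ≥0∞) (Ps : List Bool → ℕ → ℚ) : Prop :=
  Computable (fun p : List Bool × ℕ => Ps p.1 p.2) ∧
  (∀ x s, 0 ≤ Ps x s) ∧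
  (∀ x, Monotone fun s => Ps x s) ∧
  (∀ x, P x = ⨆ s, qval (Ps x s))

/-- `P` is lower semicomputable. -/
def LowerSemicomputable (P : List Bool → ℝ≥0∞) : Prop := ∃ Ps, IsApproxFromBelow P Ps

/-- `es` is a computable approximation of `e` from above (by values in `ℚ≥0 ∪ {∞}`,
nonincreasing in the stage). -/
def IsApproxFromAbove (e : List Bool → ℝ≥0∞) (es : List Bool → ℕ → Option ℚ) : Prop :=
  Computable (fun p : List Bool × ℕ => es p.1 p.2) ∧
  (∀ x s, ∀ a ∈ es x s, (0:ℚ) ≤ a) ∧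
  (∀ x, Antitone fun s => qtval (es x s)) ∧
  (∀ x, e x = ⨅ s, qtval (es x s))

/-- `e` is upper semicomputable. -/
def UpperSemicomputable (e : List Bool → ℝ≥0∞) : Prop := ∃ es, IsApproxFromAbove e es

/-- `e` is a sumtest for the semimeasure `P`. -/
def IsSumtest (P e : List Bool → ℝ≥0∞) : Prop := ∑' x, P x * e x ≤ 1

/-- `m` is a universal (lower semicomputable) semimeasure. -/
def IsUniversalSemimeasure (m : List Bool → ℝ≥0∞) : Prop :=
  IsSemimeasure m ∧ LowerSemicomputable m ∧
  ∀ P, IsSemimeasure P → LowerSemicomputable P → ∃ c : ℝ≥0, 0 < c ∧ ∀ x, P x ≤ c * m x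

/-- A conditional semimeasure `m(·|·)`. -/
def IsCondSemimeasure (m : List Bool → ℕ → ℝ≥0∞) : Prop := ∀ s, ∑' x, m x s ≤ 1

/-- `ms` is a computable approximation from below of the conditional semimeasure `m`:
`ms t x s` approximates `m(x|s)`, nondecreasing in the stage `t`. -/
def IsCondApproxFromBelow (m : List Bool → ℕ → ℝ≥0∞) (ms : ℕ → List Bool → ℕ → ℚ) : Prop :=
  Computable (fun p : ℕ × List Bool × ℕ => ms p.1 p.2.1 p.2.2) ∧
  (∀ t x s, 0 ≤ ms t x s) ∧
  (∀ x s, Monotone fun t => ms t x s) ∧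
  (∀ x s, m x s = ⨆ t, qval (ms t x s))

/-- The conditional semimeasure `m` is lower semicomputable (jointly). -/
def CondLowerSemicomputable (m : List Bool → ℕ → ℝ≥0∞) : Prop :=
  ∃ ms, IsCondApproxFromBelow m ms

/-- `m(·|·)` is a universal lower semicomputable conditional semimeasure. -/
def IsUniversalCondSemimeasure (m : List Bool → ℕ → ℝ≥0∞) : Prop :=
  IsCondSemimeasure m ∧ CondLowerSemicomputable m ∧
  ∀ m', IsCondSemimeasure m' → CondLowerSemicomputable m' →
    ∃ c : ℝ≥0, 0 < c ∧ ∀ x s, m' x s ≤ c * m x s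

section RationalCoding

open Encodable

/-- The code of a rational number in terms of its numerator and denominator, which underlies
the `Denumerable` structure of `ℚ`. -/
def ratCode (q : ℚ) : ℕ := Nat.pair (encode q.num) q.den

/-- The absolute value of the integer with code `n`. -/
def natAbsOfCode (n : ℕ) : ℕ := (n + 1) / 2

/-- The predicate singling out the codes of rational numbers. -/
def IsRatCode (n : ℕ) : Prop :=
  0 < n.unpair.2 ∧ (natAbsOfCode n.unpair.1).Coprime n.unpair.2

instance : DecidablePred IsRatCode := fun n => by unfold IsRatCode; infer_instance

theorem natAbsOfCode_encode (z : ℤ) : natAbsOfCode (encode z) = z.natAbs := by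
  cases z with
  | ofNat m =>
    change (2 * m + 1) / 2 = m
    omega
  | negSucc m =>
    change (2 * m + 1 + 1) / 2 = m + 1
    omega

theorem encode_int_mod_two_eq_zero_iff (z : ℤ) : encode z % 2 = 0 ↔ 0 ≤ z := by
  cases z with
  | ofNat m =>
    change 2 * m % 2 = 0 ↔ 0 ≤ (m : ℤ)
    omega
  | negSucc m =>
    change (2 * m + 1) % 2 = 0 ↔ 0 ≤ Int.negSucc m
    have := Int.negSucc_lt_zero m
    omega

theorem natAbsOfCode_ratCode (q : ℚ) : natAbsOfCode (ratCode q).unpair.1 = q.num.natAbs := by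
  simp [ratCode, natAbsOfCode_encode]

theorem ratCode_unpair_snd (q : ℚ) : (ratCode q).unpair.2 = q.den := by
  simp [ratCode]

theorem isRatCode_iff_exists (n : ℕ) : IsRatCode n ↔ ∃ q, ratCode q = n := by
  constructor
  · rintro ⟨hpos, hcop⟩
    have hz : encode (Denumerable.ofNat ℤ n.unpair.1) = n.unpair.1 := Denumerable.encode_ofNat _
    rw [← hz, natAbsOfCode_encode] at hcop
    exact ⟨⟨Denumerable.ofNat ℤ n.unpair.1, n.unpair.2, hpos.ne', hcop⟩,
      by rw [ratCode, hz, Nat.pair_unpair]⟩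
  · rintro ⟨q, rfl⟩
    refine ⟨?_, ?_⟩
    · rw [ratCode_unpair_snd]; exact q.pos
    · rw [natAbsOfCode_ratCode, ratCode_unpair_snd]; exact q.reduced

theorem isRatCode_ratCode (q : ℚ) : IsRatCode (ratCode q) := (isRatCode_iff_exists _).2 ⟨q, rfl⟩

theorem encode_rat_eq_count (q : ℚ) :
    @encode ℚ Primcodable.toEncodable q = Nat.count IsRatCode (ratCode q) := by
  have h : @encode ℚ Primcodable.toEncodable q = (List.range (ratCode q)).countP
      (@decide _ <| decidableRangeEncode ℚ ·) := rfl
  rw [h, Nat.count]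
  congr 1
  funext n
  rw [decide_eq_decide]
  exact (isRatCode_iff_exists n).symm

theorem primrec_natAbsOfCode : Primrec natAbsOfCode :=
  Primrec.nat_div.comp Primrec.succ (Primrec.const 2)

theorem primrecRel_coprime : PrimrecRel Nat.Coprime := by
  have hdvd : ∀ {f : ℕ × ℕ × ℕ → ℕ}, Primrec f → PrimrecPred fun p => f p % p.1 = 0 := fun hf =>
    Primrec.eq.comp (Primrec.nat_mod.comp hf Primrec.fst) (Primrec.const 0)
  have hR : PrimrecRel fun (d : ℕ) (p : ℕ × ℕ) => ¬ (d ≠ 1 ∧ p.1 % d = 0 ∧ p.2 % d = 0) := by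
    have h1 : PrimrecPred fun p : ℕ × ℕ × ℕ => p.1 = 1 :=
      Primrec.eq.comp Primrec.fst (Primrec.const 1)
    exact (h1.not.and ((hdvd (Primrec.fst.comp Primrec.snd)).and
      (hdvd (Primrec.snd.comp Primrec.snd)))).not
  have hb : Primrec fun p : ℕ × ℕ => p.1 + p.2 + 1 :=
    Primrec.succ.comp (Primrec.nat_add.comp Primrec.fst Primrec.snd)
  refine PrimrecPred.of_eq (hR.forall_mem_list.comp (Primrec.list_range.comp hb)
    Primrec.id) fun p => ?_
  obtain ⟨a, b⟩ := p
  simp only [id, List.mem_range]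
  constructor
  · intro h
    by_contra hab
    refine h (a.gcd b) ?_ ⟨hab, Nat.mod_eq_zero_of_dvd (Nat.gcd_dvd_left a b),
      Nat.mod_eq_zero_of_dvd (Nat.gcd_dvd_right a b)⟩
    rcases Nat.eq_zero_or_pos a with rfl | ha
    · simp
    · have := Nat.gcd_le_left b ha
      omega
  · rintro h d - ⟨hd, hda, hdb⟩
    exact hd (Nat.eq_one_of_dvd_coprimes h (Nat.dvd_of_mod_eq_zero hda)
      (Nat.dvd_of_mod_eq_zero hdb))

theorem primrecPred_isRatCode : PrimrecPred IsRatCode := by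
  have h1 : Primrec fun n : ℕ => n.unpair.1 := Primrec.fst.comp Primrec.unpair
  have h2 : Primrec fun n : ℕ => n.unpair.2 := Primrec.snd.comp Primrec.unpair
  exact (Primrec.nat_lt.comp (Primrec.const 0) h2).and
    (primrecRel_coprime.comp (primrec_natAbsOfCode.comp h1) h2)

theorem Primrec.nat_count {p : ℕ → Prop} [DecidablePred p] (hp : PrimrecPred p) :
    Primrec (Nat.count p) := by
  have hstep : Primrec₂ fun (n r : ℕ) => r + if p n then 1 else 0 :=
    Primrec.nat_add.comp Primrec.snd
      (Primrec.ite (hp.comp Primrec.fst) (Primrec.const 1) (Primrec.const 0))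
  refine (Primrec.nat_rec₁ 0 hstep).of_eq fun n => ?_
  induction n with
  | zero => simp
  | succ n ih => rw [Nat.count_succ, ← ih]

theorem Computable.decide_comp {α β : Type*} [Primcodable α] [Primcodable β] {R : β → Prop}
    [DecidablePred R] (hR : PrimrecPred R) {g : α → β} (hg : Computable g) :
    Computable fun a => decide (R (g a)) :=
  (primrecPred_iff_primrec_decide.1 hR).to_comp.comp hg

theorem Computable.decide_nat_le {α : Type*} [Primcodable α] {f g : α → ℕ}
    (hf : Computable f) (hg : Computable g) : Computable fun a => decide (f a ≤ g a) :=
  Computable.decide_comp (R := fun p : ℕ × ℕ => p.1 ≤ p.2) Primrec.nat_le (hf.pair hg)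

/-- A function with values in `ℕ` is computable if its graph is decidable. -/
theorem Computable.of_graph {α β : Type*} [Primcodable α] [Primcodable β] {f : α → ℕ}
    {R : β → Prop} (hR : PrimrecPred R) {g : α × ℕ → β} (hg : Computable g)
    (h : ∀ a n, R (g (a, n)) ↔ n = f a) : Computable f := by
  classical
  have hp : Computable₂ fun a n => decide (R (g (a, n))) := Computable.decide_comp hR hg
  refine (Partrec.rfind hp.partrec₂).of_eq_tot fun a => ?_
  rw [Nat.mem_rfind]
  refine ⟨Part.mem_some_iff.2 (decide_eq_true ((h a _).2 rfl)).symm,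
    fun {m} hm => Part.mem_some_iff.2 ?_⟩
  exact (decide_eq_false fun h' => hm.ne ((h a m).1 h')).symm

theorem computable_ratCode : Computable ratCode := by
  have hp : PrimrecPred fun x : ℚ × ℕ => IsRatCode x.2 ∧ 
      Nat.count IsRatCode x.2 = @encode ℚ Primcodable.toEncodable x.1 :=
    (primrecPred_isRatCode.comp Primrec.snd).and
      (Primrec.eq.comp ((Primrec.nat_count primrecPred_isRatCode).comp Primrec.snd)
        (Primrec.encode.comp Primrec.fst))
  refine Computable.of_graph hp Computable.id fun q n => ?_
  simp only [id, encode_rat_eq_count]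
  constructor
  · rintro ⟨hn, hc⟩
    exact Nat.count_injective hn (isRatCode_ratCode q) hc
  · rintro rfl
    exact ⟨isRatCode_ratCode q, rfl⟩

theorem computable_rat_natAbs_num : Computable fun q : ℚ => q.num.natAbs :=
  (primrec_natAbsOfCode.to_comp.comp
    (Computable.fst.comp (Computable.unpair.comp computable_ratCode))).of_eq natAbsOfCode_ratCode

theorem computable_rat_den : Computable Rat.den :=
  (Computable.snd.comp (Computable.unpair.comp computable_ratCode)).of_eq ratCode_unpair_snd

theorem rat_eq_natAbs_num_div_den {q : ℚ} (hq : 0 ≤ q) : q = (q.num.natAbs : ℚ) / q.den := by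
  have h : ((q.num.natAbs : ℤ) : ℚ) = (q.num : ℚ) :=
    congrArg _ (Int.natAbs_of_nonneg (Rat.num_nonneg.2 hq))
  rw [Int.cast_natCast] at h
  rw [h, Rat.num_div_den]

theorem computable_nat_div_succ : Computable₂ fun a b : ℕ => (a : ℚ) / (b + 1 : ℕ) := by
  have hp : PrimrecPred fun x : (ℕ × ℕ) × ℕ × ℕ => x.2.1 % 2 = 0 ∧
      natAbsOfCode x.2.1 * (x.1.2 + 1) = x.1.1 * x.2.2 := by
    have ha : Primrec fun x : (ℕ × ℕ) × ℕ × ℕ => x.1.1 := Primrec.fst.comp Primrec.fst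
    have hb : Primrec fun x : (ℕ × ℕ) × ℕ × ℕ => x.1.2 := Primrec.snd.comp Primrec.fst
    have hc : Primrec fun x : (ℕ × ℕ) × ℕ × ℕ => x.2.1 := Primrec.fst.comp Primrec.snd
    have hd : Primrec fun x : (ℕ × ℕ) × ℕ × ℕ => x.2.2 := Primrec.snd.comp Primrec.snd
    exact (Primrec.eq.comp (Primrec.nat_mod.comp hc (Primrec.const 2)) (Primrec.const 0)).and
      (Primrec.eq.comp (Primrec.nat_mul.comp (primrec_natAbsOfCode.comp hc)
        (Primrec.succ.comp hb)) (Primrec.nat_mul.comp ha hd))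
  have hr : Computable fun x : (ℕ × ℕ) × ℕ => (ratCode (Denumerable.ofNat ℚ x.2)).unpair :=
    Computable.unpair.comp (computable_ratCode.comp ((Computable.ofNat ℚ).comp Computable.snd))
  refine Computable.encode_iff.1
    (Computable.of_graph hp (g := fun x => (x.1, (ratCode (Denumerable.ofNat ℚ x.2)).unpair))
      (Computable.fst.pair hr) fun ab n => ?_)
  obtain ⟨a, b⟩ := ab
  obtain ⟨r, rfl⟩ : ∃ r : ℚ, n = @encode ℚ Primcodable.toEncodable r :=
    ⟨Denumerable.ofNat ℚ n, (Denumerable.encode_ofNat n).symm⟩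
  have hof : Denumerable.ofNat ℚ (@encode ℚ Primcodable.toEncodable r) = r :=
    Denumerable.ofNat_encode r
  rw [@encode_inj ℚ Primcodable.toEncodable]
  simp only [hof]
  rw [natAbsOfCode_ratCode, ratCode_unpair_snd]
  have hfst : (ratCode r).unpair.1 = encode r.num := by simp [ratCode]
  rw [hfst, encode_int_mod_two_eq_zero_iff, Rat.num_nonneg]
  have hb : ((b + 1 : ℕ) : ℚ) ≠ 0 := Nat.cast_ne_zero.2 b.succ_ne_zero
  have hd : (r.den : ℚ) ≠ 0 := Nat.cast_ne_zero.2 r.den_nz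
  constructor
  · rintro ⟨h0, h⟩
    rw [rat_eq_natAbs_num_div_den h0, div_eq_div_iff hd hb]
    exact_mod_cast h
  · intro h
    have h0 : 0 ≤ r := by rw [h]; positivity
    refine ⟨h0, ?_⟩
    rw [rat_eq_natAbs_num_div_den h0, div_eq_div_iff hd hb] at h
    exact_mod_cast h

end RationalCoding

/-- Division of nonnegative rationals with values in `ℚ≥0 ∪ {∞}`, where `0 / 0 = 0` and
`a / 0 = ∞` for `a ≠ 0`. -/
def optDiv (a b : ℚ) : Option ℚ :=
  bif decide (b.num.natAbs = 0) then
    bif decide (a.num.natAbs = 0) then some 0 else none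
  else some ((a.num.natAbs * b.den : ℕ) / ((a.den * b.num.natAbs).pred + 1 : ℕ))

/-- The minimum of two elements of `ℚ≥0 ∪ {∞}`. -/
def optMin (a b : Option ℚ) : Option ℚ :=
  a.casesOn b fun x => b.casesOn (some x) fun y =>
    bif decide (x.num.natAbs * y.den ≤ y.num.natAbs * x.den) then some x else some y

theorem computable_optDiv : Computable₂ optDiv := by
  have hz : Computable fun q : ℚ => decide (q.num.natAbs = 0) :=
    (primrecPred_iff_primrec_decide.1
      (Primrec.eq.comp Primrec.id (Primrec.const 0))).to_comp.comp computable_rat_natAbs_num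
  have hmul := Primrec.nat_mul.to_comp
  exact Computable.cond (hz.comp Computable.snd)
    (Computable.cond (hz.comp Computable.fst) (Computable.const _) (Computable.const _))
    (Computable.option_some.comp (computable_nat_div_succ.comp
      (hmul.comp (computable_rat_natAbs_num.comp Computable.fst)
        (computable_rat_den.comp Computable.snd))
      (Computable.pred.comp (hmul.comp (computable_rat_den.comp Computable.fst)
        (computable_rat_natAbs_num.comp Computable.snd)))))

theorem optDiv_nonneg {a b q : ℚ} (h : q ∈ optDiv a b) : 0 ≤ q := by
  unfold optDiv at h
  cases h1 : decide (b.num.natAbs = 0) <;> cases h2 : decide (a.num.natAbs = 0) <;>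
    simp only [h1, h2, cond_true, cond_false, Option.mem_def, Option.some.injEq,
      reduceCtorEq] at h <;> subst h <;> positivity

theorem qtval_optDiv {a b : ℚ} (ha : 0 ≤ a) (hb : 0 ≤ b) :
    qtval (optDiv a b) = qval a / qval b := by
  rcases hb.eq_or_lt with rfl | hb'
  · rcases ha.eq_or_lt with rfl | ha'
    · simp [optDiv, qtval, qval]
    · have h0 : ENNReal.ofReal (a : ℝ) ≠ 0 := by simpa using ha'
      simp [optDiv, qtval, qval, ha'.ne', ENNReal.div_zero h0]
  · have hn : b.num.natAbs ≠ 0 := by simpa using hb'.ne'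
    have hpred : (a.den * b.num.natAbs).pred + 1 = a.den * b.num.natAbs :=
      Nat.succ_pred (Nat.mul_ne_zero a.den_nz hn)
    have hval : optDiv a b = some (a / b) := by
      simp only [optDiv, hn, decide_false, cond_false, hpred]
      conv_rhs => rw [rat_eq_natAbs_num_div_den ha, rat_eq_natAbs_num_div_den hb, div_div_div_eq]
      push_cast
      rfl
    rw [hval]
    simp only [qtval, qval, Option.elim_some, Rat.cast_div]
    exact ENNReal.ofReal_div_of_pos (by exact_mod_cast hb')

theorem computable_optMin : Computable₂ optMin := by
  have hx : Computable fun p : ((Option ℚ × Option ℚ) × ℚ) × ℚ => p.1.2 :=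
    Computable.snd.comp Computable.fst
  have hy : Computable fun p : ((Option ℚ × Option ℚ) × ℚ) × ℚ => p.2 := Computable.snd
  have hle : Computable fun p : ((Option ℚ × Option ℚ) × ℚ) × ℚ =>
      decide (p.1.2.num.natAbs * p.2.den ≤ p.2.num.natAbs * p.1.2.den) :=
    Computable.decide_nat_le
      (Primrec.nat_mul.to_comp.comp (computable_rat_natAbs_num.comp hx)
        (computable_rat_den.comp hy))
      (Primrec.nat_mul.to_comp.comp (computable_rat_natAbs_num.comp hy)
        (computable_rat_den.comp hx))
  have hsome : Computable₂ fun (p : (Option ℚ × Option ℚ) × ℚ) (y : ℚ) =>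
      bif decide (p.2.num.natAbs * y.den ≤ y.num.natAbs * p.2.den) then some p.2 else some y :=
    Computable.cond hle (Computable.option_some.comp hx) (Computable.option_some.comp hy)
  have hcases : Computable₂ fun (p : Option ℚ × Option ℚ) (x : ℚ) =>
      (p.2.casesOn (some x) fun y =>
        bif decide (x.num.natAbs * y.den ≤ y.num.natAbs * x.den) then some x else some y :
        Option ℚ) :=
    Computable.option_casesOn (Computable.snd.comp Computable.fst)
      (Computable.option_some.comp Computable.snd) hsome
  exact Computable.option_casesOn Computable.fst Computable.snd hcases

theorem optMin_eq_or (a b : Option ℚ) : optMin a b = a ∨ optMin a b = b := by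
  rcases a with _ | x <;> rcases b with _ | y
  · exact Or.inl rfl
  · exact Or.inr rfl
  · exact Or.inl rfl
  · change cond _ _ _ = _ ∨ cond _ _ _ = _
    cases decide (x.num.natAbs * y.den ≤ y.num.natAbs * x.den) <;> simp

theorem qtval_optMin {a b : Option ℚ} (ha : ∀ q ∈ a, 0 ≤ q) (hb : ∀ q ∈ b, 0 ≤ q) :
    qtval (optMin a b) = min (qtval a) (qtval b) := by
  rcases a with _ | x <;> rcases b with _ | y
  · simp [optMin, qtval]
  · simp [optMin, qtval]
  · simp [optMin, qtval]
  · have hx : 0 ≤ x := ha x rfl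
    have hy : 0 ≤ y := hb y rfl
    have hdx : (0 : ℚ) < x.den := by exact_mod_cast x.pos
    have hdy : (0 : ℚ) < y.den := by exact_mod_cast y.pos
    have hiff : x.num.natAbs * y.den ≤ y.num.natAbs * x.den ↔ x ≤ y := by
      conv_rhs => rw [rat_eq_natAbs_num_div_den hx, rat_eq_natAbs_num_div_den hy,
        div_le_div_iff₀ hdx hdy]
      norm_cast
    by_cases hxy : x ≤ y
    · have hle : qtval (some x) ≤ qtval (some y) :=
        ENNReal.ofReal_le_ofReal (by exact_mod_cast hxy)
      rw [min_eq_left hle]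
      simp [optMin, hiff, hxy]
    · have hle : qtval (some y) ≤ qtval (some x) :=
        ENNReal.ofReal_le_ofReal (by exact_mod_cast (not_le.1 hxy).le)
      rw [min_eq_right hle]
      simp [optMin, hiff, hxy]

/-- The minimum of the first `s + 1` values of a sequence in `ℚ≥0 ∪ {∞}`. -/
def runningMin (w : ℕ → Option ℚ) (s : ℕ) : Option ℚ :=
  Nat.rec (w 0) (fun n r => optMin r (w (n + 1))) s

theorem runningMin_nonneg {w : ℕ → Option ℚ} (hw : ∀ s, ∀ a ∈ w s, 0 ≤ a) (s : ℕ) :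
    ∀ a ∈ runningMin w s, 0 ≤ a := by
  induction s with
  | zero => exact hw 0
  | succ n ih =>
    change ∀ a ∈ optMin (runningMin w n) (w (n + 1)), 0 ≤ a
    rcases optMin_eq_or (runningMin w n) (w (n + 1)) with h | h <;> rw [h]
    exacts [ih, hw _]

theorem qtval_runningMin_succ {w : ℕ → Option ℚ} (hw : ∀ s, ∀ a ∈ w s, 0 ≤ a) (s : ℕ) :
    qtval (runningMin w (s + 1)) = min (qtval (runningMin w s)) (qtval (w (s + 1))) :=
  qtval_optMin (runningMin_nonneg hw s) (hw _)

/-- The infimum of a computable sequence with values in `ℚ≥0 ∪ {∞}` is upper semicomputable. -/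
theorem upperSemicomputable_iInf_qtval {w : List Bool → ℕ → Option ℚ}
    (hc : Computable fun p : List Bool × ℕ => w p.1 p.2) (hw : ∀ x s, ∀ a ∈ w x s, 0 ≤ a) :
    UpperSemicomputable fun x => ⨅ s, qtval (w x s) := by
  have hanti : ∀ x, Antitone fun s => qtval (runningMin (w x) s) := fun x =>
    antitone_nat_of_succ_le fun s => by
      rw [qtval_runningMin_succ (hw x)]
      exact min_le_left _ _
  refine ⟨fun x => runningMin (w x), ?_, fun x => runningMin_nonneg (hw x), hanti, fun x => ?_⟩
  · have hw0 : Computable fun p : List Bool × ℕ => w p.1 0 :=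
      Computable.comp (g := fun p : List Bool × ℕ => (p.1, 0)) hc (Computable.fst.pair (Computable.const 0))
    have hwsucc : Computable fun p : (List Bool × ℕ) × ℕ × Option ℚ => w p.1.1 (p.2.1 + 1) :=
      Computable.comp (g := fun p : (List Bool × ℕ) × ℕ × Option ℚ => (p.1.1, p.2.1 + 1)) hc
        ((Computable.fst.comp Computable.fst).pair
        (Computable.succ.comp (Computable.fst.comp Computable.snd)))
    have hstep : Computable₂ fun (p : List Bool × ℕ) (r : ℕ × Option ℚ) =>
        optMin r.2 (w p.1 (r.1 + 1)) :=
      Computable₂.comp computable_optMin (Computable.snd.comp Computable.snd) hwsucc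
    exact Computable.nat_rec Computable.snd hw0 hstep
  · refine le_antisymm (le_iInf fun s => ?_) (le_iInf fun s => ?_)
    · induction s with
      | zero => exact iInf_le _ 0
      | succ n ih =>
        rw [qtval_runningMin_succ (hw x)]
        exact le_min ih (iInf_le _ (n + 1))
    · refine (iInf_le _ s).trans ?_
      cases s with
      | zero => exact le_rfl
      | succ n =>
        rw [qtval_runningMin_succ (hw x)]
        exact min_le_right _ _

theorem qval_mono : Monotone qval := fun _ _ h => ENNReal.ofReal_le_ofReal (by exact_mod_cast h)

/-- If `f s` increases to `P` and each `f s` weighted by `e` has total mass at most one, then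
`e` is a sumtest for `P`. -/
theorem isSumtest_of_iSup {P e : List Bool → ℝ≥0∞} {f : ℕ → List Bool → ℝ≥0∞}
    (hmono : ∀ x, Monotone fun s => f s x) (hP : ∀ x, P x = ⨆ s, f s x)
    (hf : ∀ s, ∑' x, f s x * e x ≤ 1) : IsSumtest P e := by
  unfold IsSumtest
  rw [ENNReal.tsum_eq_iSup_sum]
  refine iSup_le fun F => ?_
  simp_rw [hP, ENNReal.iSup_mul]
  rw [ENNReal.finsetSum_iSup_of_monotone fun x s t hst => mul_le_mul_left (hmono x hst) (e x)]
  exact iSup_le fun s => (ENNReal.sum_le_tsum F).trans (hf s)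

/-- Theorem 1 (first part): for any lower semicomputable semimeasure `P` with fixed
approximation `Ps`, any universal conditional semimeasure with fixed approximation `mcs`,
and any computable `h`, the function `u_h(x) = ⨅ s, m_{h(x,s)}(x|s) / P_s(x)` is an
upper semicomputable sumtest for `P`. -/
theorem u_h_is_upper_semicomputable_sumtest
    (P : List Bool → ℝ≥0∞) (Ps : List Bool → ℕ → ℚ)
    (hP : IsSemimeasure P) (hPs : IsApproxFromBelow P Ps)
    (mc : List Bool → ℕ → ℝ≥0∞) (mcs : ℕ → List Bool → ℕ → ℚ)
    (hmc : IsUniversalCondSemimeasure mc) (hmcs : IsCondApproxFromBelow mc mcs)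
    (h : List Bool × ℕ → ℕ) (hh : Computable h) :
    UpperSemicomputable (fun x => ⨅ s : ℕ, qval (mcs (h (x, s)) x s) / qval (Ps x s)) ∧
    IsSumtest P (fun x => ⨅ s : ℕ, qval (mcs (h (x, s)) x s) / qval (Ps x s)) := by
  obtain ⟨hPc, hP0, hPmono, hPsup⟩ := hPs
  obtain ⟨hmcomp, hm0, -, hmsup⟩ := hmcs
  constructor
  · simp_rw [← qtval_optDiv (hm0 _ _ _) (hP0 _ _)]
    refine upperSemicomputable_iInf_qtval ?_ fun x s a => optDiv_nonneg
    have hnum : Computable fun p : List Bool × ℕ => mcs (h (p.1, p.2)) p.1 p.2 :=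
      Computable.comp (g := fun p : List Bool × ℕ => (h p, p)) hmcomp (hh.pair Computable.id)
    exact Computable₂.comp (g := fun p : List Bool × ℕ => mcs (h (p.1, p.2)) p.1 p.2)
      (h := fun p => Ps p.1 p.2) computable_optDiv hnum hPc
  · refine isSumtest_of_iSup (fun x => qval_mono.comp (hPmono x)) hPsup fun s => ?_
    refine le_trans (ENNReal.tsum_le_tsum fun x => ?_) (hmc.1 s)
    calc qval (Ps x s) * ⨅ s, qval (mcs (h (x, s)) x s) / qval (Ps x s)
        ≤ qval (Ps x s) * (qval (mcs (h (x, s)) x s) / qval (Ps x s)) :=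
          mul_le_mul_right (iInf_le _ s) _
      _ ≤ qval (mcs (h (x, s)) x s) := ENNReal.mul_div_le
      _ ≤ mc x s := by
          rw [hmsup]
          exact le_iSup (fun t => qval (mcs t x s)) _
end

section
/- Let m be a universal semimeasure. For every upper semicomputable sumtest e for m there exists a constant C > 0 such that e(x) ≤ C · |x| · (log |x|)² for every bitstring x with |x| ≥ 2. -/
open scoped ENNReal NNReal

theorem primrecRel_coprime_s3 : PrimrecRel fun a b : ℕ => a.Coprime b := by
  have h1 : PrimrecRel fun (k : ℕ) (p : ℕ × ℕ) => ¬ (p.1 % k = 0 ∧ p.2 % k = 0) ∨ k = 1 := by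
    have hk : Primrec fun q : ℕ × ℕ × ℕ => q.1 := Primrec.fst
    have ha : Primrec fun q : ℕ × ℕ × ℕ => q.2.1 := Primrec.fst.comp Primrec.snd
    have hb : Primrec fun q : ℕ × ℕ × ℕ => q.2.2 := Primrec.snd.comp Primrec.snd
    exact (((Primrec.eq.comp (Primrec.nat_mod.comp ha hk) (Primrec.const 0)).and
      (Primrec.eq.comp (Primrec.nat_mod.comp hb hk) (Primrec.const 0))).not.or
        (Primrec.eq.comp hk (Primrec.const 1)))
  have h2 : PrimrecRel fun (n : ℕ) (p : ℕ × ℕ) =>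
      ∀ k < n, ¬ (p.1 % k = 0 ∧ p.2 % k = 0) ∨ k = 1 :=
    ((h1.forall_mem_list.comp (Primrec.list_range.comp Primrec.fst) Primrec.snd).of_eq
      fun x => by simp only [List.mem_range])
  have h3 : PrimrecPred fun p : ℕ × ℕ =>
      ∀ k < p.1 + p.2 + 2, ¬ (p.1 % k = 0 ∧ p.2 % k = 0) ∨ k = 1 :=
    h2.comp (Primrec.nat_add.comp (Primrec.nat_add.comp Primrec.fst Primrec.snd)
      (Primrec.const 2)) Primrec.id
  refine h3.of_eq fun p => ?_
  simp only [← Nat.dvd_iff_mod_eq_zero]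
  rw [Nat.coprime_iff_gcd_eq_one]
  constructor
  · intro h
    by_cases h0 : p.1.gcd p.2 < p.1 + p.2 + 2
    · exact (h _ h0).resolve_left (fun hn => hn ⟨Nat.gcd_dvd_left _ _, Nat.gcd_dvd_right _ _⟩)
    · have hle : p.1.gcd p.2 ≤ p.1 + p.2 := by
        rcases Nat.eq_zero_or_pos p.1 with h1 | h1
        · simp [h1]
        · exact (Nat.gcd_le_left _ h1).trans (Nat.le_add_right _ _)
      omega
  · intro h k _
    by_cases hk : k ∣ p.1 ∧ k ∣ p.2
    · right
      have := Nat.dvd_gcd hk.1 hk.2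
      rw [h] at this
      exact Nat.dvd_one.1 this
    · exact Or.inl hk

/-- The codes of the pairs (numerator, denominator) of reduced fractions. -/
def IsFractionCode (n : ℕ) : Prop := 0 < n.unpair.2 ∧ ((n.unpair.1 + 1) / 2).Coprime n.unpair.2

instance : DecidablePred IsFractionCode := fun _ => instDecidableAnd

theorem primrecPred_isFractionCode : PrimrecPred IsFractionCode := by
  have hu : Primrec fun n : ℕ => n.unpair.1 := Primrec.fst.comp Primrec.unpair
  have hd : Primrec fun n : ℕ => n.unpair.2 := Primrec.snd.comp Primrec.unpair
  exact (Primrec.nat_lt.comp (Primrec.const 0) hd).and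
    (primrecRel_coprime_s3.comp (Primrec.nat_div.comp
      (Primrec.nat_add.comp hu (Primrec.const 1)) (Primrec.const 2)) hd)

/-- The code of the reduced fraction representing a rational number. -/
def fractionCode (q : ℚ) : ℕ := Nat.pair (Equiv.intEquivNat q.num) q.den

theorem intEquivNat_add_one_div_two (z : ℤ) : (Equiv.intEquivNat z + 1) / 2 = z.natAbs := by
  cases z with
  | ofNat n =>
    have : Equiv.intEquivNat (Int.ofNat n) = 2 * n := rfl
    rw [this]; simp; omega
  | negSucc n =>
    have : Equiv.intEquivNat (Int.negSucc n) = 2 * n + 1 := rfl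
    rw [this]; simp; omega

theorem mem_range_fractionCode (n : ℕ) : n ∈ Set.range fractionCode ↔ IsFractionCode n := by
  constructor
  · rintro ⟨q, rfl⟩
    simp only [IsFractionCode, fractionCode, Nat.unpair_pair, intEquivNat_add_one_div_two]
    exact ⟨q.pos, q.reduced⟩
  · rintro ⟨h0, hc⟩
    obtain ⟨z, hz⟩ := Equiv.intEquivNat.surjective n.unpair.1
    rw [← hz, intEquivNat_add_one_div_two] at hc
    refine ⟨⟨z, n.unpair.2, h0.ne', hc⟩, ?_⟩
    simp [fractionCode, hz]

theorem encode_rat (q : ℚ) :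
    @Encodable.encode ℚ Primcodable.toEncodable q = Nat.count IsFractionCode (fractionCode q) := by
  have h : @Encodable.encode ℚ Primcodable.toEncodable q = (List.range (fractionCode q)).countP
      (fun n => @decide _ (Encodable.decidableRangeEncode ℚ n)) := rfl
  rw [h, Nat.count_eq_card_filter_range, List.countP_eq_length_filter]
  have h2 : ∀ n, @decide _ (Encodable.decidableRangeEncode ℚ n) = decide (IsFractionCode n) := by
    intro n
    rw [decide_eq_decide]
    exact mem_range_fractionCode n
  simp only [h2]
  rfl

theorem Computable.nat_count {α : Type*} [Primcodable α] {p : α → ℕ → Prop}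
    [∀ a, DecidablePred (p a)] (hp : Computable fun x : α × ℕ => decide (p x.1 x.2))
    {f : α → ℕ} (hf : Computable f) : Computable fun a => Nat.count (p a) (f a) := by
  have h := Computable.nat_rec (f := f) (g := fun _ : α => 0)
    (h := fun a (x : ℕ × ℕ) => x.2 + bif decide (p a x.1) then 1 else 0) hf (Computable.const 0)
    (by
      refine (Primrec.nat_add.to_comp.comp (Computable.snd.comp Computable.snd)
        (Computable.cond ?_ (Computable.const 1) (Computable.const 0)))
      exact hp.comp (Computable.pair Computable.fst (Computable.fst.comp Computable.snd)))
  refine h.of_eq fun a => ?_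
  induction f a with
  | zero => simp
  | succ n ih => rw [Nat.count_succ, ← ih]; simp [Bool.cond_decide]

theorem computable_of_fractionCode {α : Type*} [Primcodable α] {f : α → ℚ}
    (hf : Computable fun a => fractionCode (f a)) : Computable f := by
  rw [← Computable.encode_iff]
  simp only [encode_rat]
  exact Computable.nat_count (p := fun _ => IsFractionCode)
    (primrecPred_isFractionCode.decide.to_comp.comp Computable.snd) hf

theorem computable_fractionCode : Computable fractionCode := by
  have hp : Computable₂ fun (q : ℚ) (n : ℕ) =>
      decide (IsFractionCode n ∧
        Nat.count IsFractionCode n = @Encodable.encode ℚ Primcodable.toEncodable q) := by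
    have h1 : Computable fun x : ℚ × ℕ => decide (IsFractionCode x.2) :=
      primrecPred_isFractionCode.decide.to_comp.comp Computable.snd
    have h2 : Computable fun x : ℚ × ℕ => Nat.count IsFractionCode x.2 :=
      Computable.nat_count (p := fun _ => IsFractionCode)
        (primrecPred_isFractionCode.decide.to_comp.comp Computable.snd) Computable.snd
    have h3 : Computable fun x : ℚ × ℕ =>
        decide (Nat.count IsFractionCode x.2 = @Encodable.encode ℚ Primcodable.toEncodable x.1) :=
      (PrimrecRel.decide Primrec.eq).to_comp.comp
        h2 (Computable.encode.comp Computable.fst)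
    refine ((Primrec.and.to_comp.comp h1 h3)).of_eq fun x => ?_
    simp
  refine (Partrec.rfind hp.partrec₂).of_eq_tot fun q => ?_
  have hq : IsFractionCode (fractionCode q) := (mem_range_fractionCode _).1 ⟨q, rfl⟩
  obtain ⟨n, hn, -⟩ := Nat.rfind_min' (p := fun n =>
    decide (IsFractionCode n ∧
      Nat.count IsFractionCode n = @Encodable.encode ℚ Primcodable.toEncodable q))
    (m := fractionCode q)
    (by simp [hq, encode_rat])
  have hs := Nat.rfind_spec hn
  simp only [PFun.coe_val, Part.mem_some_iff, encode_rat] at hs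
  have hs' := of_decide_eq_true hs.symm
  have := Nat.count_injective hs'.1 hq hs'.2
  exact this ▸ hn

theorem Primrec.nat_pow : Primrec₂ ((· ^ ·) : ℕ → ℕ → ℕ) := by
  refine (Primrec.nat_rec' (f := fun x : ℕ × ℕ => x.2) (g := fun _ => 1)
    (h := fun x y => y.2 * x.1) Primrec.snd (Primrec.const 1)
    (Primrec.nat_mul.comp (Primrec.snd.comp Primrec.snd)
      (Primrec.fst.comp Primrec.fst))).of_eq fun x => ?_
  induction x.2 with
  | zero => simp
  | succ n ih => simp only [pow_succ, ← ih]

theorem computable_inv_two_pow : Computable fun n : ℕ => (1 / 2 ^ n : ℚ) := by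
  apply computable_of_fractionCode
  have h : Primrec fun n : ℕ => Nat.pair 2 (2 ^ n) :=
    Primrec₂.natPair.comp (Primrec.const 2) (Primrec.nat_pow.comp (Primrec.const 2) Primrec.id)
  refine h.to_comp.of_eq fun n => ?_
  have hq : (1 / 2 ^ n : ℚ) = ⟨1, 2 ^ n, by positivity, by simp⟩ := by
    rw [Rat.mk_eq_divInt, Rat.divInt_eq_div]; simp
  rw [hq]
  rfl

/-- Test whether a value in `ℚ≥0 ∪ {∞}` exceeds `2 ^ a`. -/
def exceedsPow (q : Option ℚ) (a : ℕ) : Bool :=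
  q.casesOn true fun q => decide (2 ^ a * (fractionCode q).unpair.2 <
    (fractionCode q).unpair.1 / 2)

theorem computable_exceedsPow : Computable₂ exceedsPow := by
  refine Computable.option_casesOn (o := fun x : Option ℚ × ℕ => x.1) (f := fun _ => true)
    (g := fun (x : Option ℚ × ℕ) (q : ℚ) => decide (2 ^ x.2 * (fractionCode q).unpair.2 <
    (fractionCode q).unpair.1 / 2)) Computable.fst (Computable.const true) ?_
  have hc : Computable fun y : (Option ℚ × ℕ) × ℚ => (fractionCode y.2).unpair :=
    Computable.unpair.comp (computable_fractionCode.comp Computable.snd)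
  have h2 : Computable fun y : (Option ℚ × ℕ) × ℚ => 2 ^ y.1.2 :=
    Primrec.nat_pow.to_comp.comp (Computable.const 2) (Computable.snd.comp Computable.fst)
  exact (PrimrecRel.decide Primrec.nat_lt).to_comp.comp
    (Primrec.nat_mul.to_comp.comp h2 (Computable.snd.comp hc))
    (Primrec.nat_div.to_comp.comp (Computable.fst.comp hc) (Computable.const 2))

theorem exceedsPow_iff {q : Option ℚ} (hq : ∀ a ∈ q, (0 : ℚ) ≤ a) (a : ℕ) :
    exceedsPow q a = true ↔ 2 ^ a < qtval q := by
  cases q with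
  | none => simp [exceedsPow, qtval]
  | some q =>
    have h0 : 0 ≤ q := hq q rfl
    have hcode : (fractionCode q).unpair.1 / 2 = q.num.toNat := by
      obtain ⟨n, hn⟩ := Int.eq_ofNat_of_zero_le (Rat.num_nonneg.2 h0)
      have : Equiv.intEquivNat (n : ℤ) = 2 * n := rfl
      simp [fractionCode, hn, this]
    have hden : (fractionCode q).unpair.2 = q.den := by simp [fractionCode]
    have hpow : (2 : ℝ≥0∞) ^ a = ENNReal.ofReal (2 ^ a) := by
      rw [ENNReal.ofReal_pow (by norm_num)]; norm_num
    have hlt : (2 : ℝ) ^ a < (q : ℝ) ↔ (2 : ℚ) ^ a < q := by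
      rw [← Rat.cast_lt (K := ℝ)]; push_cast; rfl
    have hnum : ((q.num.toNat : ℕ) : ℚ) = q.num := by
      exact_mod_cast congrArg (Int.cast (R := ℚ)) (Int.toNat_of_nonneg (Rat.num_nonneg.2 h0))
    simp only [exceedsPow, qtval, Option.elim_some, decide_eq_true_eq, hcode, hden]
    rw [hpow, ENNReal.ofReal_lt_ofReal_iff_of_nonneg (by positivity), hlt,
      ← Nat.cast_lt (α := ℚ), hnum]
    conv_rhs => rw [← Rat.num_div_den q]
    rw [lt_div_iff₀ (by exact_mod_cast q.pos)]
    push_cast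
    rfl

theorem Computable.list_countP {α β : Type*} [Primcodable α] [Primcodable β] {p : α → β → Bool}
    (hp : Computable₂ p) {f : α → List β} (hf : Computable f) :
    Computable fun a => (f a).countP (p a) := by
  have hi : Computable fun x : α × ℕ => (f x.1)[x.2]? :=
    Computable.list_getElem?.comp (hf.comp Computable.fst) Computable.snd
  have hq : Computable fun x : α × ℕ => decide (((f x.1)[x.2]?).any (p x.1) = true) := by
    refine (Computable.option_casesOn (f := fun _ => false)
      (g := fun (x : α × ℕ) b => p x.1 b) hi (Computable.const false)
      (hp.comp (Computable.fst.comp Computable.fst) Computable.snd)).of_eq fun x => ?_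
    cases (f x.1)[x.2]? <;> simp
  refine (Computable.nat_count (p := fun a i => ((f a)[i]?).any (p a) = true) hq
    (Computable.list_length.comp hf)).of_eq fun a => ?_
  generalize f a = L
  induction L using List.reverseRecOn with
  | nil => simp
  | append_singleton L b ih =>
    rw [List.length_append, List.length_singleton, Nat.count_succ, List.countP_append, ← ih]
    congr 1
    · simp only [Nat.count_eq_card_filter_range]
      congr 1
      refine Finset.filter_congr fun i hi => ?_
      rw [List.getElem?_append_left (Finset.mem_range.1 hi)]
    · simp [List.countP_singleton]

/-- The bitstrings of length less than `n`. -/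
def shortStrings : ℕ → List (List Bool)
  | 0 => []
  | n + 1 => [] :: ((shortStrings n).map (List.cons true) ++ (shortStrings n).map (List.cons false))

theorem mem_shortStrings {n : ℕ} {x : List Bool} : x ∈ shortStrings n ↔ x.length < n := by
  induction n generalizing x with
  | zero => simp [shortStrings]
  | succ n ih =>
    cases x with
    | nil => simp [shortStrings]
    | cons b x => cases b <;> simp [shortStrings, ih]

theorem nodup_shortStrings (n : ℕ) : (shortStrings n).Nodup := by
  induction n with
  | zero => simp [shortStrings]
  | succ n ih =>
    refine List.nodup_cons.2 ⟨by simp, List.nodup_append.2 ⟨ih.map List.cons_injective,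
      ih.map List.cons_injective, ?_⟩⟩
    simp

theorem length_shortStrings_lt (n : ℕ) : (shortStrings n).length < 2 ^ n := by
  induction n with
  | zero => simp [shortStrings]
  | succ n ih => simp [shortStrings, pow_succ]; omega

theorem primrec_shortStrings : Primrec shortStrings := by
  have hm (b : Bool) : Primrec fun y : ℕ × ℕ × List (List Bool) => y.2.2.map (List.cons b) :=
    Primrec.list_map (Primrec.snd.comp Primrec.snd)
      (Primrec.list_cons.comp (Primrec.const b) Primrec.snd)
  refine (Primrec.nat_rec' (f := fun n : ℕ => n) (g := fun _ => ([] : List (List Bool)))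
    (h := fun _ y => [] :: (y.2.map (List.cons true) ++ y.2.map (List.cons false)))
    Primrec.id (Primrec.const []) (Primrec.list_cons.comp (Primrec.const [])
      (Primrec.list_append.comp (hm true) (hm false)))).of_eq fun n => ?_
  induction n with
  | zero => rfl
  | succ n ih => simp only [shortStrings, ← ih]

theorem qval_one_div_two_pow (n : ℕ) : qval (1 / 2 ^ n) = 2⁻¹ ^ n := by
  have : (((1 / 2 ^ n : ℚ)) : ℝ) = (2⁻¹ : ℝ) ^ n := by push_cast; simp
  rw [qval, this, ENNReal.ofReal_pow (by norm_num), ENNReal.ofReal_inv_of_pos (by norm_num)]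
  norm_num

/-- Weights `2⁻¹ ^ D i` placed on uniformly recursively enumerable sets of bitstrings can be
combined into one lower semicomputable function. -/
theorem exists_lowerSemicomputable_of_enumerable {ι : Type*} [Denumerable ι] {D : ι → ℕ}
    (hD : Computable D) {b : List Bool → ℕ} (hb : Computable b) {R : ι → ℕ → List Bool → Bool}
    (hR : Computable fun z : (ι × ℕ) × List Bool => R z.1.1 z.1.2 z.2) :
    ∃ P : List Bool → ℝ≥0∞, LowerSemicomputable P ∧
      (∀ i t x, R i t x = true → 2⁻¹ ^ D i ≤ P x) ∧
      ∀ x, P x ≤ 2⁻¹ ^ b x + ∑' i, ⨆ _ : ∃ t, R i t x = true, 2⁻¹ ^ D i := by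
  obtain ⟨dec, hdecc, hdecs⟩ : ∃ dec : ℕ → ι × ℕ, Computable dec ∧ Function.Surjective dec :=
    ⟨Denumerable.ofNat (ι × ℕ), Computable.ofNat _, fun y => ⟨_, Denumerable.ofNat_encode y⟩⟩
  set d : List Bool → ℕ → ℕ := fun x s => Nat.rec (motive := fun _ => ℕ) (b x)
    (fun v d => bif R (dec v).1 (dec v).2 x then min d (D (dec v).1) else d) s with hd
  have hd0 (x) : d x 0 = b x := rfl
  have hds (x s) : d x (s + 1) =
    bif R (dec s).1 (dec s).2 x then min (d x s) (D (dec s).1) else d x s := rfl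
  have hdc : Computable fun p : List Bool × ℕ => d p.1 p.2 := by
    have hv : Computable fun z : (List Bool × ℕ) × ℕ × ℕ => dec z.2.1 :=
      hdecc.comp (Computable.fst.comp Computable.snd)
    have hz : Computable fun z : (List Bool × ℕ) × ℕ × ℕ => z.2.2 :=
      Computable.snd.comp Computable.snd
    refine Computable.nat_rec (f := fun p : List Bool × ℕ => p.2) (g := fun p => b p.1)
      (h := fun p z => bif R (dec z.1).1 (dec z.1).2 p.1 then min z.2 (D (dec z.1).1) else z.2)
      Computable.snd (hb.comp Computable.fst) (Computable.cond ?_ ?_ hz)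
    · exact hR.comp (hv.pair (Computable.fst.comp Computable.fst))
    · have hDv : Computable fun z : (List Bool × ℕ) × ℕ × ℕ => D (dec z.2.1).1 :=
        hD.comp (Computable.fst.comp hv)
      exact Primrec.nat_min.to_comp.comp hz hDv
  have hanti (x) : Antitone (d x) := antitone_nat_of_succ_le fun s => by
    rw [hds]; cases R (dec s).1 (dec s).2 x <;> simp
  refine ⟨fun x => ⨆ s, qval (1 / 2 ^ d x s), ⟨fun x s => 1 / 2 ^ d x s,
    computable_inv_two_pow.comp hdc, fun x s => by positivity, fun x s s' h => ?_,
    fun x => rfl⟩, fun i t x h => ?_, fun x => ?_⟩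
  · have := hanti x h
    dsimp only
    gcongr
    norm_num
  · simp only [qval_one_div_two_pow]
    obtain ⟨v, hv⟩:= hdecs (i, t)
    refine le_trans ?_ (le_iSup (fun s => (2⁻¹ : ℝ≥0∞) ^ d x s) (v + 1))
    refine pow_le_pow_right_of_le_one' (by simp) ?_
    rw [hds, hv]
    simp [h]
  · simp only [qval_one_div_two_pow]
    refine iSup_le fun s => ?_
    induction s with
    | zero => rw [hd0]; exact le_self_add
    | succ s ih =>
      rw [hds]
      cases h : R (dec s).1 (dec s).2 x with
      | false => simpa using ih
      | true =>
        rw [cond_true]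
        rcases min_choice (d x s) (D (dec s).1) with h' | h' <;> rw [h']
        · exact ih
        · refine le_trans ?_ le_add_self
          refine le_trans ?_ (ENNReal.le_tsum (dec s).1)
          exact le_iSup (fun _ : ∃ t, R (dec s).1 t x = true => (2⁻¹ : ℝ≥0∞) ^ D (dec s).1)
            ⟨_, h⟩

theorem ENNReal.two_pow_mul_inv_two_pow_add (a b : ℕ) :
    (2 : ℝ≥0∞) ^ a * 2⁻¹ ^ (a + b) = 2⁻¹ ^ b := by
  rw [pow_add, ← mul_assoc, ← mul_pow, ENNReal.mul_inv_cancel (by simp) (by simp), one_pow,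
    one_mul]

theorem ENNReal.tsum_inv_two_pow_add (n : ℕ) : ∑' j, (2⁻¹ : ℝ≥0∞) ^ (n + 1 + j) = 2⁻¹ ^ n := by
  simp_rw [pow_add _ (n + 1)]
  rw [ENNReal.tsum_mul_left, ENNReal.tsum_geometric, ENNReal.one_sub_inv_two, inv_inv, pow_succ,
    mul_assoc, ENNReal.inv_mul_cancel (by simp) (by simp), mul_one]

theorem ENNReal.tsum_ite_lt (N : ℕ) (c : ℝ≥0∞) : ∑' l, (if l < N then c else 0) = N * c := by
  rw [tsum_eq_sum (s := Finset.range N) (fun l hl => if_neg (by simpa using hl)),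
    Finset.sum_congr rfl (fun l hl => if_pos (Finset.mem_range.1 hl))]
  simp

theorem tsum_iSup_exists_mem_of_card_lt {α : Type*} {A : ℕ → Finset α} (hA : Antitone A) (N : ℕ)
    (c : ℝ≥0∞) : ∑' x, ⨆ _ : ∃ t, (A t).card < N ∧ x ∈ A t, c ≤ N * c := by
  classical
  by_cases h : ∃ t, (A t).card < N
  · calc ∑' x, ⨆ _ : ∃ t, (A t).card < N ∧ x ∈ A t, c
        ≤ ∑' x, (if x ∈ A (Nat.find h) then c else 0) := by
          refine ENNReal.tsum_le_tsum fun x => iSup_le fun ⟨t, ht, hx⟩ => ?_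
          rw [if_pos (hA (Nat.find_min' h ht) hx)]
      _ = (A (Nat.find h)).card * c := by
          rw [tsum_eq_sum (s := A (Nat.find h)) (fun x hx => if_neg hx),
            Finset.sum_congr rfl (fun x hx => if_pos hx)]
          simp
      _ ≤ N * c := by
          gcongr
          exact (Nat.find_spec h).le
  · have : ∀ x, ¬ ∃ t, (A t).card < N ∧ x ∈ A t := fun x ⟨t, ht, _⟩ => h ⟨t, ht⟩
    simp [this]

/-- The strings of length less than `2 ^ k` whose stage-`t` value exceeds `2 ^ a`. -/
def exceedingStrings (es : List Bool → ℕ → Option ℚ) (k a t : ℕ) : Finset (List Bool) :=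
  ((shortStrings (2 ^ k)).filter fun y => exceedsPow (es y t) a).toFinset

theorem mem_exceedingStrings {es : List Bool → ℕ → Option ℚ} {k a t : ℕ} {x : List Bool} :
    x ∈ exceedingStrings es k a t ↔ x.length < 2 ^ k ∧ exceedsPow (es x t) a = true := by
  simp [exceedingStrings, mem_shortStrings]

theorem card_exceedingStrings (es : List Bool → ℕ → Option ℚ) (k a t : ℕ) :
    (exceedingStrings es k a t).card =
      (shortStrings (2 ^ k)).countP fun y => exceedsPow (es y t) a := by
  rw [exceedingStrings, List.toFinset_card_of_nodup ((nodup_shortStrings _).filter _),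
    List.countP_eq_length_filter]

theorem card_exceedingStrings_lt (es : List Bool → ℕ → Option ℚ) (k a t : ℕ) :
    (exceedingStrings es k a t).card < 2 ^ 2 ^ k := by
  rw [card_exceedingStrings]
  exact List.countP_le_length.trans_lt (length_shortStrings_lt _)

theorem antitone_exceedingStrings {e : List Bool → ℝ≥0∞} {es : List Bool → ℕ → Option ℚ}
    (he : IsApproxFromAbove e es) (k a : ℕ) : Antitone (exceedingStrings es k a) := by
  intro t t' h x hx
  rw [mem_exceedingStrings, exceedsPow_iff (he.2.1 x _)] at hx ⊢
  exact ⟨hx.1, hx.2.trans_le (he.2.2.1 x h)⟩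

theorem tsum_weights_le :
    ∑' i : (ℕ × ℕ) × ℕ × ℕ, (if i.1.2 < 2 ^ i.1.1 then if i.2.2 < 2 ^ i.1.2 then
      (2⁻¹ : ℝ≥0∞) ^ (i.1.2 + (2 * i.1.1 + i.2.1 + 4)) else 0 else 0) ≤ 2⁻¹ ^ 1 := by
  have hj (p k : ℕ) : ∑' j, ∑' l, (if k < 2 ^ p then if l < 2 ^ k then
      (2⁻¹ : ℝ≥0∞) ^ (k + (2 * p + j + 4)) else 0 else 0) =
      if k < 2 ^ p then 2⁻¹ ^ (p + (p + 3)) else 0 := by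
    split_ifs with h
    · rw [← Nat.add_assoc, ← two_mul, ← ENNReal.tsum_inv_two_pow_add]
      refine tsum_congr fun j => ?_
      rw [ENNReal.tsum_ite_lt, Nat.cast_pow, Nat.cast_ofNat, ENNReal.two_pow_mul_inv_two_pow_add]
      congr 1
      omega
    · simp
  rw [ENNReal.tsum_prod', ENNReal.tsum_prod']
  simp_rw [ENNReal.tsum_prod', hj, ENNReal.tsum_ite_lt, Nat.cast_pow, Nat.cast_ofNat,
    ENNReal.two_pow_mul_inv_two_pow_add]
  calc ∑' p, (2⁻¹ : ℝ≥0∞) ^ (p + 3) = ∑' p, 2⁻¹ ^ (2 + 1 + p) :=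
        tsum_congr fun p => by rw [Nat.add_comm]
    _ = 2⁻¹ ^ 2 := ENNReal.tsum_inv_two_pow_add 2
    _ ≤ 2⁻¹ ^ 1 := pow_le_pow_right_of_le_one' (by simp) (by norm_num)

/-- For each `k < 2 ^ p`, each threshold `2 ^ (2 * p + k + 2 * j)` and each `l < 2 ^ k`, a
semimeasure gives weight `2⁻¹ ^ (2 * p + k + j + l + 5)` to the strings of length less than `2 ^ k`
that at some stage belong to a set of fewer than `2 ^ (l + 1)` strings exceeding the threshold. -/
theorem exists_semimeasure_exceedingStrings {e : List Bool → ℝ≥0∞}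
    {es : List Bool → ℕ → Option ℚ} (he : IsApproxFromAbove e es) :
    ∃ P, IsSemimeasure P ∧ LowerSemicomputable P ∧ ∀ p k j l t x, k < 2 ^ p → l < 2 ^ k →
      (exceedingStrings es k (2 * p + k + 2 * j) t).card < 2 ^ (l + 1) →
      x ∈ exceedingStrings es k (2 * p + k + 2 * j) t → 2⁻¹ ^ (2 * p + k + j + l + 5) ≤ P x := by
  let a : (ℕ × ℕ) × ℕ × ℕ → ℕ := fun i => 2 * i.1.1 + i.1.2 + 2 * i.2.1
  let D : (ℕ × ℕ) × ℕ × ℕ → ℕ := fun i => 2 * i.1.1 + i.1.2 + i.2.1 + i.2.2 + 5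
  let R : (ℕ × ℕ) × ℕ × ℕ → ℕ → List Bool → Bool := fun i t x =>
    (decide (i.1.2 < 2 ^ i.1.1) && decide (i.2.2 < 2 ^ i.1.2)) &&
    (decide ((shortStrings (2 ^ i.1.2)).countP (fun y => exceedsPow (es y t) (a i))
      < 2 ^ (i.2.2 + 1)) &&
    (decide (x.length < 2 ^ i.1.2) && exceedsPow (es x t) (a i)))
  have hR (i t x) : R i t x = true ↔ (i.1.2 < 2 ^ i.1.1 ∧ i.2.2 < 2 ^ i.1.2) ∧
      (exceedingStrings es i.1.2 (a i) t).card < 2 ^ (i.2.2 + 1) ∧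
      x ∈ exceedingStrings es i.1.2 (a i) t := by
    simp only [R, Bool.and_eq_true, decide_eq_true_eq, card_exceedingStrings,
      mem_exceedingStrings]
  have hp : Primrec fun i : (ℕ × ℕ) × ℕ × ℕ => i.1.1 := Primrec.fst.comp Primrec.fst
  have hk : Primrec fun i : (ℕ × ℕ) × ℕ × ℕ => i.1.2 := Primrec.snd.comp Primrec.fst
  have hj : Primrec fun i : (ℕ × ℕ) × ℕ × ℕ => i.2.1 := Primrec.fst.comp Primrec.snd
  have hl : Primrec fun i : (ℕ × ℕ) × ℕ × ℕ => i.2.2 := Primrec.snd.comp Primrec.snd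
  have h2pk : Primrec fun i : (ℕ × ℕ) × ℕ × ℕ => 2 * i.1.1 + i.1.2 :=
    Primrec.nat_add.comp (Primrec.nat_mul.comp (Primrec.const 2) hp) hk
  have ha : Primrec a := Primrec.nat_add.comp h2pk (Primrec.nat_mul.comp (Primrec.const 2) hj)
  have hD : Primrec D := Primrec.nat_add.comp (Primrec.nat_add.comp
    (Primrec.nat_add.comp h2pk hj) hl) (Primrec.const 5)
  have hpow {f : (ℕ × ℕ) × ℕ × ℕ → ℕ} (hf : Primrec f) : Primrec fun i => 2 ^ f i :=
    Primrec.nat_pow.comp (Primrec.const 2) hf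
  have hlt {α : Type} [Primcodable α] {f g : α → ℕ} (hf : Computable f) (hg : Computable g) :
      Computable fun z => decide (f z < g z) :=
    (PrimrecRel.decide Primrec.nat_lt).to_comp.comp hf hg
  have hand {α : Type} [Primcodable α] {f g : α → Bool} (hf : Computable f) (hg : Computable g) :
      Computable fun z => f z && g z := Primrec.and.to_comp.comp hf hg
  have hi : Computable fun z : (((ℕ × ℕ) × ℕ × ℕ) × ℕ) × List Bool => z.1.1 :=
    Computable.fst.comp Computable.fst
  have ht : Computable fun z : (((ℕ × ℕ) × ℕ × ℕ) × ℕ) × List Bool => z.1.2 :=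
    Computable.snd.comp Computable.fst
  have hex {α : Type} [Primcodable α] {f : α → List Bool} {g h : α → ℕ} (hf : Computable f)
      (hg : Computable g) (hh : Computable h) :
      Computable fun z => exceedsPow (es (f z) (g z)) (h z) :=
    computable_exceedsPow.comp (he.1.comp (hf.pair hg)) hh
  have hcount : Computable fun z : (((ℕ × ℕ) × ℕ × ℕ) × ℕ) × List Bool =>
      (shortStrings (2 ^ z.1.1.1.2)).countP (fun y => exceedsPow (es y z.1.2) (a z.1.1)) := by
    refine Computable.list_countP
      (p := fun (z : (((ℕ × ℕ) × ℕ × ℕ) × ℕ) × List Bool) y => exceedsPow (es y z.1.2) (a z.1.1))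
      (hex Computable.snd (ht.comp Computable.fst) (ha.to_comp.comp (hi.comp Computable.fst)))
      ((primrec_shortStrings.comp (hpow hk)).to_comp.comp hi)
  have hRc : Computable fun z : (((ℕ × ℕ) × ℕ × ℕ) × ℕ) × List Bool => R z.1.1 z.1.2 z.2 :=
    hand (hand (hlt (hk.to_comp.comp hi) ((hpow hp).to_comp.comp hi))
      (hlt (hl.to_comp.comp hi) ((hpow hk).to_comp.comp hi)))
      (hand (hlt hcount ((hpow (Primrec.succ.comp hl)).to_comp.comp hi))
      (hand (hlt (Computable.list_length.comp Computable.snd) ((hpow hk).to_comp.comp hi))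
        (hex Computable.snd ht (ha.to_comp.comp hi))))
  obtain ⟨P, hP, hPR, hPle⟩ := exists_lowerSemicomputable_of_enumerable hD.to_comp
    (b := fun x => 1 + 1 + Encodable.encode x)
    (Primrec.nat_add.to_comp.comp (Computable.const (1 + 1)) Computable.encode) hRc
  refine ⟨P, ?_, hP, fun p k j l t x h1 h2 h3 h4 =>
    hPR ((p, k), (j, l)) t x ((hR _ _ _).2 ⟨⟨h1, h2⟩, h3, h4⟩)⟩
  have hbase : ∑' x : List Bool, (2⁻¹ : ℝ≥0∞) ^ (1 + 1 + Encodable.encode x) ≤ 2⁻¹ ^ 1 := by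
    rw [← ENNReal.tsum_inv_two_pow_add 1]
    exact ENNReal.tsum_comp_le_tsum_of_injective Encodable.encode_injective
      fun n => (2⁻¹ : ℝ≥0∞) ^ (1 + 1 + n)
  have hsum (i) : ∑' x, ⨆ _ : ∃ t, R i t x = true, (2⁻¹ : ℝ≥0∞) ^ D i ≤
      if i.1.2 < 2 ^ i.1.1 then if i.2.2 < 2 ^ i.1.2 then
        2⁻¹ ^ (i.1.2 + (2 * i.1.1 + i.2.1 + 4)) else 0 else 0 := by
    simp only [hR]
    split_ifs with h1 h2
    · simp only [h1, h2, true_and]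
      refine (tsum_iSup_exists_mem_of_card_lt
        (antitone_exceedingStrings he i.1.2 (a i)) _ _).trans_eq ?_
      have hDi : D i = i.2.2 + 1 + (i.1.2 + (2 * i.1.1 + i.2.1 + 4)) := by simp only [D]; omega
      rw [Nat.cast_pow, Nat.cast_ofNat, hDi, ENNReal.two_pow_mul_inv_two_pow_add]
    · simp [h2]
    · simp [h1]
  calc ∑' x, P x ≤ ∑' x, (2⁻¹ ^ (1 + 1 + Encodable.encode x) +
        ∑' i, ⨆ _ : ∃ t, R i t x = true, 2⁻¹ ^ D i) := ENNReal.tsum_le_tsum hPle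
    _ = ∑' x : List Bool, 2⁻¹ ^ (1 + 1 + Encodable.encode x) +
        ∑' i, ∑' x, ⨆ _ : ∃ t, R i t x = true, 2⁻¹ ^ D i := by
      rw [ENNReal.tsum_add, ENNReal.tsum_comm]
    _ ≤ 2⁻¹ ^ 1 + 2⁻¹ ^ 1 :=
      add_le_add hbase ((ENNReal.tsum_le_tsum hsum).trans tsum_weights_le)
    _ = 1 := by rw [pow_one, ENNReal.inv_two_add_inv_two]

theorem exists_sumtest_le_two_pow {m : List Bool → ℝ≥0∞} (hm : IsUniversalSemimeasure m)
    {e : List Bool → ℝ≥0∞} (he : UpperSemicomputable e) (hse : IsSumtest m e) :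
    ∃ j : ℕ, ∀ p k x, k < 2 ^ p → x.length < 2 ^ k → e x ≤ 2 ^ (2 * p + k + 2 * j) := by
  obtain ⟨es, hes⟩ := he
  obtain ⟨P, hP1, hP2, hP⟩ := exists_semimeasure_exceedingStrings hes
  obtain ⟨c, -, hc⟩ := hm.2.2 P hP1 hP2
  obtain ⟨j, hj⟩ := exists_nat_gt (c * 2 ^ 5 : ℝ≥0)
  refine ⟨j, fun p k x hk hx => ?_⟩
  by_contra! hlt
  set a := 2 * p + k + 2 * j with ha
  have hmem (t) : x ∈ exceedingStrings es k a t := by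
    rw [mem_exceedingStrings, exceedsPow_iff (hes.2.1 x t)]
    exact ⟨hx, hlt.trans_le (by rw [hes.2.2.2 x]; exact iInf_le _ t)⟩
  obtain ⟨t, ht⟩ : ∃ t, ∀ t', (exceedingStrings es k a t).card ≤
      (exceedingStrings es k a t').card :=
    ⟨Function.argmin fun t => (exceedingStrings es k a t).card,
      fun t' => Function.argmin_le (fun t => (exceedingStrings es k a t).card) t'⟩
  set S := exceedingStrings es k a t with hS
  have hstable (t') : S ⊆ exceedingStrings es k a t' := by
    rcases le_total t t' with h | h
    · exact (Finset.eq_of_subset_of_card_le (antitone_exceedingStrings hes k a h) (ht t')).ge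
    · exact antitone_exceedingStrings hes k a h
  have hSe (y) (hy : y ∈ S) : 2 ^ a ≤ e y := by
    rw [hes.2.2.2 y]
    refine le_iInf fun t' => ?_
    have := hstable t' hy
    rw [mem_exceedingStrings, exceedsPow_iff (hes.2.1 y _)] at this
    exact this.2.le
  have hS0 : S.card ≠ 0 := Finset.card_ne_zero_of_mem (hmem t)
  set l := Nat.log 2 S.card with hl
  have hlk : l < 2 ^ k := Nat.log_lt_of_lt_pow hS0 (card_exceedingStrings_lt es k a t)
  have hSP (y) (hy : y ∈ S) : 2⁻¹ ^ (2 * p + k + j + l + 5) ≤ P y :=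
    hP p k j l t y hk hlk (Nat.lt_pow_succ_log_self (by norm_num) _) hy
  have hSl : (2 : ℝ≥0∞) ^ l ≤ S.card := by exact_mod_cast Nat.pow_log_le_self 2 hS0
  have hbound : (2 : ℝ≥0∞) ^ l * (2⁻¹ ^ (2 * p + k + j + l + 5) * 2 ^ a) ≤ c := by
    calc (2 : ℝ≥0∞) ^ l * (2⁻¹ ^ (2 * p + k + j + l + 5) * 2 ^ a)
        ≤ S.card * (2⁻¹ ^ (2 * p + k + j + l + 5) * 2 ^ a) := by gcongr
      _ = ∑ y ∈ S, 2⁻¹ ^ (2 * p + k + j + l + 5) * 2 ^ a := by simp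
      _ ≤ ∑ y ∈ S, c * (m y * e y) := by
          refine Finset.sum_le_sum fun y hy => ?_
          rw [← mul_assoc]
          exact mul_le_mul' ((hSP y hy).trans (hc y)) (hSe y hy)
      _ ≤ ∑' y, c * (m y * e y) := ENNReal.sum_le_tsum S
      _ = c * ∑' y, m y * e y := ENNReal.tsum_mul_left
      _ ≤ c * 1 := by gcongr; exact hse
      _ = c := mul_one _
  have hpow : (2 : ℝ≥0∞) ^ j ≤ c * 2 ^ 5 := by
    calc (2 : ℝ≥0∞) ^ j = 2 ^ j * (2 ^ (2 * p + k + j + l + 5) *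
          2⁻¹ ^ (2 * p + k + j + l + 5 + 0)) := by
            rw [ENNReal.two_pow_mul_inv_two_pow_add, pow_zero, mul_one]
      _ = 2 ^ l * (2⁻¹ ^ (2 * p + k + j + l + 5) * 2 ^ a) * 2 ^ 5 := by
          rw [ha]; ring
      _ ≤ c * 2 ^ 5 := by gcongr
  have hpow' : (2 : ℝ≥0) ^ j ≤ c * 2 ^ 5 := by exact_mod_cast hpow
  have hj2 : (j : ℝ≥0) < 2 ^ j := by exact_mod_cast Nat.lt_two_pow_self
  exact absurd (hj.trans hj2) hpow'.not_gt

/-- Theorem 2: every upper semicomputable sumtest `e` for a universal semimeasure `m`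
satisfies `e(x) ≤ O(|x| (log |x|)²)`. -/
theorem upper_bound_for_upper_semicomputable_sumtests
    (m : List Bool → ℝ≥0∞) (hm : IsUniversalSemimeasure m)
    (e : List Bool → ℝ≥0∞) (he : UpperSemicomputable e) (hse : IsSumtest m e) :
    ∃ C : ℝ, 0 < C ∧ ∀ x : List Bool, 2 ≤ x.length →
      e x ≤ ENNReal.ofReal (C * x.length * (Real.logb 2 x.length) ^ 2) := by
  obtain ⟨j, hj⟩ := exists_sumtest_le_two_pow hm he hse
  refine ⟨2 ^ (2 * j) * 32, by positivity, fun x hx => ?_⟩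
  set n := x.length with hn
  set k := Nat.log 2 n + 1 with hk
  set p := Nat.log 2 k + 1 with hp
  have hkp : k < 2 ^ p := Nat.lt_pow_succ_log_self (by norm_num) _
  have hnk : n < 2 ^ k := Nat.lt_pow_succ_log_self (by norm_num) _
  refine (hj p k x hkp hnk).trans ?_
  have hpow : (2 : ℝ≥0∞) ^ (2 * p + k + 2 * j) = ENNReal.ofReal (2 ^ (2 * p + k + 2 * j)) := by
    rw [ENNReal.ofReal_pow (by norm_num)]; norm_num
  rw [hpow]
  apply ENNReal.ofReal_le_ofReal
  have hk2 : (2 : ℝ) ^ k ≤ 2 * n := by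
    have := Nat.pow_log_le_self 2 (show n ≠ 0 by omega)
    rw [hk, pow_succ, mul_comm]
    exact_mod_cast Nat.mul_le_mul_left 2 this
  have hp2 : (2 : ℝ) ^ p ≤ 2 * k := by
    have := Nat.pow_log_le_self 2 (show k ≠ 0 by omega)
    rw [hp, pow_succ, mul_comm]
    exact_mod_cast Nat.mul_le_mul_left 2 this
  have hlog : (k : ℝ) ≤ 2 * Real.logb 2 n := by
    have h1 : (Nat.log 2 n : ℝ) ≤ Real.logb 2 n := Real.natLog_le_logb n 2
    have h2 : (1 : ℝ) ≤ Nat.log 2 n := by exact_mod_cast Nat.log_pos (by norm_num) hx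
    rw [hk]
    push_cast
    linarith
  calc (2 : ℝ) ^ (2 * p + k + 2 * j) = 2 ^ (2 * j) * ((2 ^ p) ^ 2 * 2 ^ k) := by ring
    _ ≤ 2 ^ (2 * j) * ((2 * (2 * Real.logb 2 n)) ^ 2 * (2 * n)) := by
      gcongr
      exact hp2.trans (by gcongr)
    _ = 2 ^ (2 * j) * 32 * n * Real.logb 2 n ^ 2 := by ring
end
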